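/- Let β₀ ∈ (0,1) be a real number and let m₀ ≥ 7 be an integer. Then there exists H > 0 such that for every real h₀ ≥ H the following hold: setting K₀ := D̄(0,1) and K_{j+1} := D̄(h₀·e^{2πij/m₀}, 1) for j = 0, 1, …, m₀−1, the discs K₀, K₁, …, K_{m₀} are pairwise disjoint, the set L := ⋃_{i=0}^{m₀} K_i is compact with connected complement and with connected components K₀, …, K_{m₀}, one has ρ_L < β₀, and U(0, K₀, Π, (β₀^n)) ≠ ∅, where Π := ⋃_{j=1}^{m₀} K_j. -/

import Mathlib

open Filter Topology Metric

/-- The `n`-th partial sum of the Taylor series of `f` at `z₀`: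
`S_n(f,z₀)(z) = Σ_{k=0}^{n} (f^{(k)}(z₀)/k!)·(z−z₀)^k`. -/
noncomputable def taylorSum (f : ℂ → ℂ) (z₀ : ℂ) (n : ℕ) (z : ℂ) : ℂ :=
  ∑ k ∈ Finset.range (n + 1), (iteratedDeriv k f z₀ / (Nat.factorial k)) * (z - z₀) ^ k

/-- Supremum norm of `g` on `X`. -/
noncomputable def supNorm (g : ℂ → ℂ) (X : Set ℂ) : ℝ :=
  sSup ((fun z => ‖g z‖) '' X)

/-- Membership in `A(X)`: continuous on `X` and holomorphic on the interior of `X`. -/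
def memA (X : Set ℂ) (f : ℂ → ℂ) : Prop :=
  ContinuousOn f X ∧ DifferentiableOn ℂ f (interior X)

/-- The universal class `U(z₀, K₀, Π, (β_n))`: elements `f` of `A(K₀)` such that
`{β_n · S_n(f, z₀)|_Π : n ≥ 1}` is dense in `A(Π)` for the sup norm on `Π`. -/
def Uuniv (z₀ : ℂ) (K₀ P : Set ℂ) (β : ℕ → ℂ) : Set (ℂ → ℂ) :=
  {f | memA K₀ f ∧ ∀ h : ℂ → ℂ, memA P h → ∀ ε : ℝ, 0 < ε →
    ∃ n : ℕ, 1 ≤ n ∧ supNorm (fun z => β n * taylorSum f z₀ n z - h z) P < ε}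

/-- Best sup-norm approximation error of `G` on `L` by polynomials of degree at most `n`. -/
noncomputable def dApprox (L : Set ℂ) (G : ℂ → ℂ) (n : ℕ) : ℝ :=
  sInf {c : ℝ | ∃ p : Polynomial ℂ, p.degree ≤ (n : ℕ) ∧
    c = supNorm (fun z => G z - Polynomial.eval z p) L}

/-- The asymptotic quantity `limsup_n d_n(G)^{1/n}`; for a function `G` which is equal to a
different polynomial on each connected component of `L` this is the asymptotic convergence
factor `ρ_L` of `L`. -/
noncomputable def rho (L : Set ℂ) (G : ℂ → ℂ) : ℝ :=
  Filter.limsup (fun n : ℕ => dApprox L G n ^ (1 / (n : ℝ))) Filter.atTop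

/-- The family of closed unit discs: `K₀ = D̄(0,1)` and
`K_{j+1} = D̄(h₀ e^{2πij/m₀}, 1)` for `j = 0, …, m₀ − 1`. -/
noncomputable def diskFamily (m₀ : ℕ) (h₀ : ℝ) (i : Fin (m₀ + 1)) : Set ℂ :=
  if i = 0 then Metric.closedBall 0 1
  else Metric.closedBall
    ((h₀ : ℂ) * Complex.exp (2 * Real.pi * Complex.I * (((i : ℕ) - 1 : ℕ) : ℂ) / (m₀ : ℂ))) 1

lemma compl_balls_connected {n : ℕ} (c : Fin n → ℂ)
    (hc : ∀ i j, i ≠ j → 5 ≤ ‖c i - c j‖) :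
    IsConnected (⋃ i, closedBall (c i) 1)ᶜ := by
  have h0 : IsConnected (Set.range c)ᶜ :=
    (Set.finite_range c).countable.isConnected_compl_of_one_lt_rank (by simp)
  let ψ : ℂ → ℂ := fun z =>
    z + ∑ i, ((max 0 (1 - ‖z - c i‖ / 2) / ‖z - c i‖ : ℝ) : ℂ) * (z - c i)
  have hψc : ContinuousOn ψ (Set.range c)ᶜ := by
    apply ContinuousOn.add continuousOn_id
    apply continuousOn_finsetSum
    intro i _
    apply ContinuousOn.mul _ (by fun_prop)
    apply Complex.continuous_ofReal.comp_continuousOn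
    apply ContinuousOn.div (by fun_prop) (by fun_prop)
    intro z hz h
    apply hz
    rw [norm_eq_zero, sub_eq_zero] at h
    exact ⟨i, h.symm⟩
  have hin : ∀ i z, ‖z - c i‖ < 2 → ψ z = z + (((1 - ‖z - c i‖ / 2) / ‖z - c i‖ : ℝ) : ℂ) * (z - c i) := by
    intro i z hz
    simp only [ψ]
    rw [Finset.sum_eq_single i]
    · rw [max_eq_right (by linarith)]
    · intro j _ hj
      have h1 := hc i j (Ne.symm hj)
      have h2 : ‖c i - c j‖ ≤ ‖z - c i‖ + ‖z - c j‖ := by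
        have := norm_sub_le (z - c j) (z - c i)
        rw [show z - c j - (z - c i) = c i - c j by ring] at this
        linarith
      rw [max_eq_left (by linarith)]
      simp
    · simp
  have hout : ∀ z, (∀ i, 2 ≤ ‖z - c i‖) → ψ z = z := by
    intro z hz
    simp only [ψ]
    rw [Finset.sum_eq_zero]
    · simp
    · intro i _
      rw [max_eq_left (by linarith [hz i])]
      simp
  have himg : ψ '' (Set.range c)ᶜ = (⋃ i, closedBall (c i) 1)ᶜ := by
    ext w
    simp only [Set.mem_image, Set.mem_compl_iff, Set.mem_range, Set.mem_iUnion, mem_closedBall,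
      dist_eq_norm, not_exists, not_le]
    constructor
    · rintro ⟨z, hz, rfl⟩ j
      by_cases h : ∃ i, ‖z - c i‖ < 2
      · obtain ⟨i, hi⟩ := h
        have hpos : 0 < ‖z - c i‖ := by
          rw [norm_pos_iff, sub_ne_zero]
          exact fun h => hz i h.symm
        have e : ψ z - c i = ((1 + (1 - ‖z - c i‖ / 2) / ‖z - c i‖ : ℝ) : ℂ) * (z - c i) := by
          rw [hin i z hi]; push_cast; ring
        have hn : ‖ψ z - c i‖ = 1 + ‖z - c i‖ / 2 := by
          rw [e, norm_mul, Complex.norm_real, Real.norm_of_nonneg]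
          · field_simp; ring
          · have : 0 ≤ (1 - ‖z - c i‖ / 2) / ‖z - c i‖ := div_nonneg (by linarith) hpos.le
            linarith
        by_cases hij : i = j
        · subst hij; linarith
        · have h1 := hc i j hij
          have := norm_sub_le (ψ z - c j) (ψ z - c i)
          rw [show ψ z - c j - (ψ z - c i) = c i - c j by ring] at this
          linarith
      · push Not at h
        rw [hout z h]
        linarith [h j]
    · intro hw
      by_cases h : ∃ i, ‖w - c i‖ < 2
      · obtain ⟨i, hi⟩ := h
        have h1 := hw i
        set t := ‖w - c i‖ with ht
        let z : ℂ := c i + ((2 * (t - 1) / t : ℝ) : ℂ) * (w - c i)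
        have hzc : z - c i = ((2 * (t - 1) / t : ℝ) : ℂ) * (w - c i) := by simp [z]
        have hzn : ‖z - c i‖ = 2 * (t - 1) := by
          rw [hzc, norm_mul, Complex.norm_real, Real.norm_of_nonneg, ← ht]
          · field_simp
          · apply div_nonneg <;> linarith
        refine ⟨z, ?_, ?_⟩
        · intro j hj
          by_cases hij : i = j
          · subst hij
            rw [hj] at hzn
            simp at hzn
            linarith
          · have := hc i j hij
            rw [hj, norm_sub_rev, hzn] at this
            linarith
        · rw [hin i z (by rw [hzn]; linarith), hzn, hzc]
          have ht0 : (t : ℂ) ≠ 0 := by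
            exact_mod_cast (by linarith : t ≠ 0)
          have ht1 : (t : ℂ) - 1 ≠ 0 := by
            exact_mod_cast (by linarith : t - 1 ≠ 0)
          simp only [z]
          push_cast
          field_simp
          ring
      · push Not at h
        refine ⟨w, ?_, hout w h⟩
        intro i hi
        have := h i
        rw [hi] at this
        simp at this
        linarith
  rw [← himg]
  exact h0.image _ hψc

/-- Two-sided binomial polynomial. -/
noncomputable def bPoly (v : Polynomial ℂ) (k : ℕ) : Polynomial ℂ :=
  ∑ s ∈ (Finset.range (2 * k + 1)).filter (fun s => k ≤ s),
    v ^ s * (1 - v) ^ (2 * k - s) * ((2 * k).choose s : Polynomial ℂ)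

lemma sum_bound (x y : ℂ) (δ : ℝ) (hδ1 : δ ≤ 1) (hx : ‖x‖ ≤ δ) (hy : ‖y‖ ≤ 2) (k : ℕ)
    (S : Finset ℕ) (hS : S ⊆ Finset.range (2 * k + 1)) (hk : ∀ s ∈ S, k ≤ s) :
    ‖∑ s ∈ S, x ^ s * y ^ (2 * k - s) * ((2 * k).choose s : ℂ)‖ ≤ (8 * δ) ^ k := by
  have hδ0 : 0 ≤ δ := (norm_nonneg _).trans hx
  calc _ ≤ ∑ s ∈ S, δ ^ k * 2 ^ k * ((2 * k).choose s : ℝ) := by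
        apply norm_sum_le_of_le
        intro s hs
        rw [norm_mul, norm_mul, norm_pow, norm_pow, Complex.norm_natCast]
        have h1 : ‖x‖ ^ s ≤ δ ^ k :=
          (pow_le_pow_left₀ (norm_nonneg _) hx s).trans (pow_le_pow_of_le_one hδ0 hδ1 (hk s hs))
        have h2 : ‖y‖ ^ (2 * k - s) ≤ 2 ^ k :=
          (pow_le_pow_left₀ (norm_nonneg _) hy _).trans
            (pow_le_pow_right₀ (by norm_num) (by have := hk s hs; omega))
        gcongr
    _ ≤ ∑ s ∈ Finset.range (2 * k + 1), δ ^ k * 2 ^ k * ((2 * k).choose s : ℝ) := by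
        apply Finset.sum_le_sum_of_subset_of_nonneg hS
        intros; positivity
    _ = (8 * δ) ^ k := by
        rw [← Finset.mul_sum, ← Nat.cast_sum, Nat.sum_range_choose, pow_mul]
        push_cast
        rw [← mul_pow, ← mul_pow]; congr 1; ring

lemma bPoly_eval (v : Polynomial ℂ) (k : ℕ) (z : ℂ) : (bPoly v k).eval z =
    ∑ s ∈ (Finset.range (2 * k + 1)).filter (fun s => k ≤ s),
    (v.eval z) ^ s * (1 - v.eval z) ^ (2 * k - s) * ((2 * k).choose s : ℂ) := by
  simp [bPoly, Polynomial.eval_finsetSum]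

lemma bPoly_bound0 (v : Polynomial ℂ) (δ : ℝ) (hδ1 : δ ≤ 1) (k : ℕ) (z : ℂ)
    (h : ‖v.eval z‖ ≤ δ) : ‖(bPoly v k).eval z‖ ≤ (8 * δ) ^ k := by
  rw [bPoly_eval]
  apply sum_bound _ _ δ hδ1 h _ k _ (Finset.filter_subset _ _)
  · simp
  · calc _ ≤ ‖(1:ℂ)‖ + ‖v.eval z‖ := norm_sub_le _ _
      _ ≤ 2 := by simp; linarith

lemma bPoly_bound1 (v : Polynomial ℂ) (δ : ℝ) (hδ1 : δ ≤ 1) (k : ℕ) (z : ℂ)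
    (h : ‖v.eval z - 1‖ ≤ δ) : ‖(bPoly v k).eval z - 1‖ ≤ (8 * δ) ^ k := by
  rw [bPoly_eval]
  set x := v.eval z
  have h1 : (∑ s ∈ Finset.range (2 * k + 1), (1 - x) ^ s * x ^ (2 * k - s) * ((2 * k).choose s : ℂ)) = 1 := by
    rw [← add_pow]; simp
  have h2 : (∑ s ∈ Finset.range (2 * k + 1), x ^ s * (1 - x) ^ (2 * k - s) * ((2 * k).choose s : ℂ)) = 1 := by
    rw [← add_pow]; simp
  rw [← Finset.sum_filter_add_sum_filter_not _ (fun s => k ≤ s)] at h2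
  have h3 : (∑ s ∈ (Finset.range (2 * k + 1)).filter (fun s => ¬ k ≤ s),
      x ^ s * (1 - x) ^ (2 * k - s) * ((2 * k).choose s : ℂ)) =
      ∑ s ∈ (Finset.range (2 * k + 1)).filter (fun s => k < s),
      (1 - x) ^ s * x ^ (2 * k - s) * ((2 * k).choose s : ℂ) := by
    apply Finset.sum_bij' (fun s _ => 2 * k - s) (fun s _ => 2 * k - s)
    · intro s hs; simp at hs ⊢; omega
    · intro s hs; simp at hs ⊢; omega
    · intro s hs; simp at hs ⊢; omega
    · intro s hs; simp at hs ⊢; omega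
    · intro s hs
      simp at hs
      rw [Nat.choose_symm (by omega), show 2 * k - (2 * k - s) = s by omega]
      ring
  rw [h3] at h2
  rw [eq_sub_of_add_eq h2, sub_sub_cancel_left, norm_neg]
  apply sum_bound _ _ δ hδ1 _ _ k _ (Finset.filter_subset _ _)
  · intro s hs; simp at hs; omega
  · rw [norm_sub_rev]; exact h
  · calc _ = ‖(x - 1) + 1‖ := by simp
      _ ≤ ‖x - 1‖ + ‖(1:ℂ)‖ := norm_add_le _ _
      _ ≤ 2 := by simp; linarith

lemma bPoly_dvd (v : Polynomial ℂ) (k : ℕ) : v ^ k ∣ bPoly v k := by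
  apply Finset.dvd_sum
  intro s hs
  simp at hs
  rw [mul_assoc]
  exact (pow_dvd_pow v hs.2).mul_right _

lemma bPoly_natDegree (v : Polynomial ℂ) (k m : ℕ) (hv : v.natDegree ≤ m) :
    (bPoly v k).natDegree ≤ 2 * m * k := by
  apply Polynomial.natDegree_sum_le_of_forall_le
  intro s hs
  simp at hs
  have h1 : (1 - v).natDegree ≤ m := by
    apply (Polynomial.natDegree_sub_le _ _).trans; simp [hv]
  have e : s * m + (2 * k - s) * m = 2 * m * k := by
    rw [← add_mul]; rw [show s + (2 * k - s) = 2 * k by omega]; ring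
  calc _ ≤ (v ^ s * (1 - v) ^ (2 * k - s)).natDegree + ((2 * k).choose s : Polynomial ℂ).natDegree :=
        Polynomial.natDegree_mul_le
    _ ≤ (v ^ s).natDegree + ((1 - v) ^ (2 * k - s)).natDegree + 0 := by
        gcongr
        · exact Polynomial.natDegree_mul_le
        · simp
    _ ≤ s * m + (2 * k - s) * m + 0 := by
        gcongr
        · exact Polynomial.natDegree_pow_le_of_le s hv
        · exact Polynomial.natDegree_pow_le_of_le _ h1
    _ = _ := by rw [add_zero, e]

lemma disc_approx (c : ℂ) (g : ℂ → ℂ) (hg : ContinuousOn g (closedBall c 1))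
    (hd : DifferentiableOn ℂ g (ball c 1)) (ε : ℝ) (hε : 0 < ε) :
    ∃ p : Polynomial ℂ, ∀ z ∈ closedBall c 1, ‖p.eval z - g z‖ ≤ ε := by
  have huc := (isCompact_closedBall c 1).uniformContinuousOn_of_continuous hg
  rw [Metric.uniformContinuousOn_iff] at huc
  obtain ⟨δ, hδ, H⟩ := huc (ε / 2) (by positivity)
  obtain ⟨r, hr0, hr1, hrδ⟩ : ∃ r : ℝ, 0 < r ∧ r < 1 ∧ 1 - r < δ := by
    refine ⟨max (1/2) (1 - δ / 2), by positivity, ?_, ?_⟩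
    · apply max_lt <;> linarith
    · have := le_max_right (1/2 : ℝ) (1 - δ / 2)
      linarith
  have hfp : HasFPowerSeriesOnBall g (cauchyPowerSeries g c ((1 : NNReal) : ℝ)) c (1 : NNReal) := by
    apply DiffContOnCl.hasFPowerSeriesOnBall _ one_pos
    refine ⟨by simpa using hd, ?_⟩
    rw [closure_ball _ (by simp)]
    simpa using hg
  obtain ⟨r', hr'1, hr'2⟩ := exists_between hr1
  lift r' to NNReal using (hr0.trans hr'1).le
  have hu := hfp.tendstoUniformlyOn (r' := r') (by exact_mod_cast hr'2)
  rw [Metric.tendstoUniformlyOn_iff] at hu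
  obtain ⟨n, hn⟩ := (hu (ε / 2) (by positivity)).exists
  set P := cauchyPowerSeries g c ((1 : NNReal) : ℝ)
  refine ⟨∑ k ∈ Finset.range n, Polynomial.C (P.coeff k) *
    (Polynomial.C (r : ℂ) * (Polynomial.X - Polynomial.C c)) ^ k, ?_⟩
  intro z hz
  have hz' : ‖z - c‖ ≤ 1 := by simpa [dist_eq_norm] using hz
  have hnorm : ‖(r : ℂ) * (z - c)‖ ≤ r := by
    rw [norm_mul, Complex.norm_real, Real.norm_of_nonneg hr0.le]
    nlinarith
  have h1 := hn ((r : ℂ) * (z - c)) (by simp only [mem_ball, dist_zero_right]; linarith)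
  have h2 := H (c + (r : ℂ) * (z - c)) (by simp only [mem_closedBall, dist_eq_norm]; rw [add_sub_cancel_left]; linarith) z hz (by
    rw [dist_eq_norm, show c + (r : ℂ) * (z - c) - z = -(((1 - r : ℝ) : ℂ) * (z - c)) by push_cast; ring,
      norm_neg, norm_mul, Complex.norm_real, Real.norm_of_nonneg (by linarith)]
    nlinarith [norm_nonneg (z - c)])
  have e : Polynomial.eval z (∑ k ∈ Finset.range n, Polynomial.C (P.coeff k) *
    (Polynomial.C (r : ℂ) * (Polynomial.X - Polynomial.C c)) ^ k) = P.partialSum n ((r : ℂ) * (z - c)) := by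
    rw [FormalMultilinearSeries.partialSum, Polynomial.eval_finsetSum]
    apply Finset.sum_congr rfl
    intro k _
    rw [FormalMultilinearSeries.apply_eq_pow_smul_coeff]
    simp [mul_comm]
  rw [e, ← dist_eq_norm]
  have := dist_triangle_left (P.partialSum n ((r : ℂ) * (z - c))) (g z) (g (c + (r : ℂ) * (z - c)))
  linarith

lemma supNorm_le (g : ℂ → ℂ) (X : Set ℂ) (c : ℝ) (hc : 0 ≤ c) (h : ∀ z ∈ X, ‖g z‖ ≤ c) :
    supNorm g X ≤ c := by
  apply Real.sSup_le _ hc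
  rintro _ ⟨z, hz, rfl⟩
  exact h z hz

lemma supNorm_nonneg (g : ℂ → ℂ) (X : Set ℂ) : 0 ≤ supNorm g X := by
  apply Real.sSup_nonneg
  rintro _ ⟨z, hz, rfl⟩
  exact norm_nonneg _

lemma bPoly_bound (v : Polynomial ℂ) (δ : ℝ) (hδ1 : δ ≤ 1) (k : ℕ) (z : ℂ) (P : Prop) [Decidable P]
    (h : ‖v.eval z - (if P then 1 else 0)‖ ≤ δ) (q : ℝ) (m : ℕ) (hq : 8 * δ ≤ q ^ (2 * m)) :
    ‖(bPoly v k).eval z - (if P then 1 else 0)‖ ≤ q ^ (2 * m * k) := by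
  have hδ0 : 0 ≤ δ := (norm_nonneg _).trans h
  have : ‖(bPoly v k).eval z - (if P then 1 else 0)‖ ≤ (8 * δ) ^ k := by
    split_ifs at h ⊢
    · exact bPoly_bound1 v δ hδ1 k z h
    · rw [sub_zero] at h ⊢
      exact bPoly_bound0 v δ hδ1 k z h
  rw [pow_mul]
  exact this.trans (pow_le_pow_left₀ (by positivity) hq k)

lemma rho_lt (m : ℕ) (hm : 0 < m) (K : Fin (m + 1) → Set ℂ) (v : Fin (m + 1) → Polynomial ℂ)
    (hdeg : ∀ i, (v i).natDegree ≤ m) (β : ℝ) (hβ : β ∈ Set.Ioo (0 : ℝ) 1) (δ : ℝ) (hδ1 : δ ≤ 1)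
    (hq : 8 * δ ≤ (β / 4) ^ (2 * m))
    (hv : ∀ i l, ∀ z ∈ K l, ‖(v i).eval z - (if i = l then 1 else 0)‖ ≤ δ)
    (F : ℂ → ℂ) (hF : ∀ l, ∀ z ∈ K l, F z = ((l : ℕ) : ℂ)) : rho (⋃ i, K i) F < β := by
  obtain ⟨hβ0, hβ1⟩ := hβ
  set q := β / 4 with hqd
  have hq0 : 0 < q := by positivity
  have hq1 : q ≤ 1 := by linarith
  set M : ℝ := ∑ i : Fin (m + 1), ((i : ℕ) : ℝ)
  have hM : 0 ≤ M := by positivity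
  have hd0 : ∀ n, 0 ≤ dApprox (⋃ i, K i) F n := by
    intro n
    apply Real.sInf_nonneg
    rintro _ ⟨p, _, rfl⟩
    exact supNorm_nonneg _ _
  have key : ∀ n, dApprox (⋃ i, K i) F n ≤ M / q ^ (2 * m) * q ^ n := by
    intro n
    set k := n / (2 * m) with hk
    have hkn : 2 * m * k ≤ n := Nat.mul_div_le n (2 * m)
    have hkn' : n ≤ 2 * m * k + 2 * m := by
      have := Nat.lt_mul_div_succ n (show 0 < 2 * m by omega)
      rw [← hk, mul_add] at this; omega
    have h1 : dApprox (⋃ i, K i) F n ≤ M * q ^ (2 * m * k) := by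
      let p : Polynomial ℂ := ∑ i : Fin (m + 1), Polynomial.C ((i : ℕ) : ℂ) * bPoly (v i) k
      have hp : p.degree ≤ (n : ℕ) := by
        apply Polynomial.degree_le_of_natDegree_le
        apply Polynomial.natDegree_sum_le_of_forall_le
        intro i _
        exact (Polynomial.natDegree_C_mul_le _ _).trans ((bPoly_natDegree _ k m (hdeg i)).trans hkn)
      have hle : dApprox (⋃ i, K i) F n ≤ supNorm (fun z => F z - p.eval z) (⋃ i, K i) := by
        apply csInf_le
        · refine ⟨0, ?_⟩
          rintro _ ⟨p, _, rfl⟩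
          exact supNorm_nonneg _ _
        · exact ⟨p, hp, rfl⟩
      refine hle.trans ?_
      · apply supNorm_le _ _ _ (by positivity)
        intro z hz
        obtain ⟨l, hl⟩ := Set.mem_iUnion.1 hz
        have e : F z - p.eval z = -∑ i : Fin (m + 1), ((i : ℕ) : ℂ) *
            ((bPoly (v i) k).eval z - (if i = l then 1 else 0)) := by
          rw [hF l z hl]
          simp [p, Polynomial.eval_finsetSum, mul_sub, Finset.sum_sub_distrib]
        rw [e, norm_neg, Finset.sum_mul]
        apply norm_sum_le_of_le
        intro i _
        rw [norm_mul, Complex.norm_natCast]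
        gcongr
        exact bPoly_bound _ δ hδ1 k z _ (hv i l z hl) q m hq
    refine h1.trans ?_
    rw [div_mul_eq_mul_div, le_div_iff₀ (by positivity), mul_assoc, ← pow_add]
    gcongr M * ?_
    exact pow_le_pow_of_le_one hq0.le hq1 hkn'
  have hev : ∀ᶠ n : ℕ in atTop, dApprox (⋃ i, K i) F n ^ (1 / (n : ℝ)) ≤ β / 2 := by
    have h2 : ∀ᶠ n : ℕ in atTop, M / q ^ (2 * m) ≤ 2 ^ n :=
      (tendsto_pow_atTop_atTop_of_one_lt (by norm_num : (1 : ℝ) < 2)).eventually_ge_atTop _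
    filter_upwards [h2, eventually_gt_atTop 0] with n hn hn0
    have h3 : dApprox (⋃ i, K i) F n ≤ (β / 2) ^ n := by
      refine (key n).trans ?_
      calc _ ≤ 2 ^ n * q ^ n := by gcongr
        _ = _ := by rw [← mul_pow]; congr 1; rw [hqd]; ring
    calc _ ≤ ((β / 2) ^ n) ^ (1 / (n : ℝ)) := Real.rpow_le_rpow (hd0 n) h3 (by positivity)
      _ = β / 2 := by
        rw [one_div]
        exact Real.pow_rpow_inv_natCast (by positivity) hn0.ne'
  have hle : rho (⋃ i, K i) F ≤ β / 2 := by
    apply Filter.limsup_le_of_le _ hev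
    apply IsCoboundedUnder.of_frequently_ge (a := 0)
    exact (Eventually.of_forall fun n => Real.rpow_nonneg (hd0 n) _).frequently
  linarith

lemma step_lemma (m : ℕ) (hm : 0 < m) (K : Fin (m + 1) → Set ℂ) (v : Fin (m + 1) → Polynomial ℂ)
    (hK : IsCompact (⋃ i, K i))
    (hdeg : ∀ i, (v i).natDegree ≤ m) (β : ℝ) (hβ : β ∈ Set.Ioo (0 : ℝ) 1) (δ : ℝ) (hδ1 : δ ≤ 1)
    (hq : 8 * δ ≤ (β / 4) ^ (2 * m))
    (hv : ∀ i l, ∀ z ∈ K l, ‖(v i).eval z - (if i = l then 1 else 0)‖ ≤ δ)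
    (hX : ∀ i, i ≠ 0 → Polynomial.X ∣ v i)
    (P : Polynomial ℂ) (N : ℕ) (p : Fin (m + 1) → Polynomial ℂ) (hp0 : p 0 = 0)
    (ε : ℝ) (hε : 0 < ε) :
    ∃ (n : ℕ) (Q : Polynomial ℂ), N ≤ n ∧ Polynomial.X ^ N ∣ Q ∧ Q.natDegree ≤ n ∧
      (∀ z ∈ K 0, ‖Q.eval z‖ ≤ ε) ∧
      ∀ l, l ≠ 0 → ∀ z ∈ K l, ‖(β : ℂ) ^ n * (P + Q).eval z - (p l).eval z‖ ≤ ε := by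
  obtain ⟨hβ0, hβ1⟩ := hβ
  set q := β / 4 with hqd
  have hq0 : 0 < q := by positivity
  obtain ⟨M, hM⟩ := hK.exists_bound_of_continuousOn
    (f := fun z => ∑ i, ‖(p i).eval z‖ + ‖P.eval z‖) (by fun_prop)
  have hM1 : ∀ l, ∀ z ∈ K l, ∑ i, ‖(p i).eval z‖ + ‖P.eval z‖ ≤ max M 0 := by
    intro l z hz
    exact ((le_abs_self _).trans (hM z (Set.mem_iUnion.2 ⟨l, hz⟩))).trans (le_max_left _ _)
  have hM0 : 0 ≤ max M 0 := le_max_right _ _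
  generalize max M 0 = M' at hM1 hM0
  obtain ⟨d, hd⟩ : ∃ d : ℕ, ∀ i, (p i).natDegree ≤ d :=
    ⟨Finset.univ.sup fun i => (p i).natDegree,
      fun i => Finset.le_sup (f := fun i => (p i).natDegree) (Finset.mem_univ i)⟩
  have t1 : ∀ᶠ k : ℕ in atTop, M' / β ^ d * (1 / 2 : ℝ) ^ k < ε / 2 := by
    have := (tendsto_pow_atTop_nhds_zero_of_lt_one (r := (1 / 2 : ℝ)) (by norm_num)
      (by norm_num)).const_mul (M' / β ^ d)
    rw [mul_zero] at this
    exact this.eventually_lt_const (by positivity)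
  have t3 : ∀ᶠ k : ℕ in atTop, M' * β ^ k < ε / 2 := by
    have := (tendsto_pow_atTop_nhds_zero_of_lt_one hβ0.le hβ1).const_mul M'
    rw [mul_zero] at this
    exact this.eventually_lt_const (by positivity)
  have t2 : ∀ᶠ k : ℕ in atTop, M' * (1 / 2 : ℝ) ^ k < ε / 2 := by
    have := (tendsto_pow_atTop_nhds_zero_of_lt_one (r := (1 / 2 : ℝ)) (by norm_num)
      (by norm_num)).const_mul M'
    rw [mul_zero] at this
    exact this.eventually_lt_const (by positivity)
  obtain ⟨k, h1, h2, h3, hkN⟩ := (t1.and (t2.and (t3.and (eventually_ge_atTop N)))).exists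
  have hkm : k ≤ 2 * m * k := Nat.le_mul_of_pos_left k (by omega)
  set n := 2 * m * k + d with hn
  have hβc : (β : ℂ) ≠ 0 := by exact_mod_cast hβ0.ne'
  let R : Polynomial ℂ := ∑ i, p i * bPoly (v i) k
  have hR : ∀ l, ∀ z ∈ K l, ‖R.eval z - (p l).eval z‖ ≤ M' * q ^ (2 * m * k) := by
    intro l z hz
    have e : R.eval z - (p l).eval z = ∑ i, (p i).eval z *
        ((bPoly (v i) k).eval z - (if i = l then 1 else 0)) := by
      simp [R, Polynomial.eval_finsetSum, mul_sub, Finset.sum_sub_distrib]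
    rw [e]
    calc _ ≤ ∑ i, ‖(p i).eval z‖ * q ^ (2 * m * k) := by
          apply norm_sum_le_of_le
          intro i _
          rw [norm_mul]
          gcongr
          exact bPoly_bound _ δ hδ1 k z _ (hv i l z hz) q m hq
      _ ≤ _ := by
          rw [← Finset.sum_mul]
          gcongr
          linarith [hM1 l z hz, norm_nonneg (P.eval z)]
  have hqk : q ^ (2 * m * k) ≤ β ^ (2 * m * k) * (1 / 2) ^ k := by
    have : q ^ (2 * m * k) = β ^ (2 * m * k) * (1 / 4) ^ (2 * m * k) := by
      rw [← mul_pow]; congr 1; rw [hqd]; ring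
    rw [this]
    gcongr
    calc (1 / 4 : ℝ) ^ (2 * m * k) ≤ (1 / 4) ^ k :=
          pow_le_pow_of_le_one (by norm_num) (by norm_num) hkm
      _ ≤ (1 / 2) ^ k := by gcongr; norm_num
  refine ⟨n, Polynomial.C ((β : ℂ) ^ n)⁻¹ * R, by omega, ?_, ?_, ?_, ?_⟩
  · apply Dvd.dvd.mul_left
    apply Finset.dvd_sum
    intro i _
    by_cases hi : i = 0
    · rw [hi, hp0]; simp
    · apply Dvd.dvd.mul_left
      exact (pow_dvd_pow _ hkN).trans ((pow_dvd_pow_of_dvd (hX i hi) k).trans (bPoly_dvd _ _))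
  · refine (Polynomial.natDegree_C_mul_le _ _).trans ?_
    apply Polynomial.natDegree_sum_le_of_forall_le
    intro i _
    refine Polynomial.natDegree_mul_le.trans ?_
    have := bPoly_natDegree (v i) k m (hdeg i)
    have := hd i
    omega
  · intro z hz
    have := hR 0 z hz
    rw [hp0, Polynomial.eval_zero, sub_zero] at this
    rw [Polynomial.eval_mul, Polynomial.eval_C, norm_mul, norm_inv, norm_pow, Complex.norm_real,
      Real.norm_of_nonneg hβ0.le]
    calc (β ^ n)⁻¹ * ‖R.eval z‖ ≤ (β ^ n)⁻¹ * (M' * (β ^ (2 * m * k) * (1 / 2) ^ k)) := by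
          gcongr
          exact this.trans (by gcongr)
      _ = M' / β ^ d * (1 / 2 : ℝ) ^ k := by
          rw [hn, pow_add]; field_simp
      _ ≤ ε := by linarith
  · intro l _ z hz
    have e : (β : ℂ) ^ n * (P + Polynomial.C ((β : ℂ) ^ n)⁻¹ * R).eval z - (p l).eval z =
        (β : ℂ) ^ n * P.eval z + (R.eval z - (p l).eval z) := by
      simp only [Polynomial.eval_add, Polynomial.eval_mul, Polynomial.eval_C]
      field_simp
      ring
    rw [e]
    have a1 : ‖(β : ℂ) ^ n * P.eval z‖ ≤ M' * β ^ k := by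
      rw [norm_mul, norm_pow, Complex.norm_real, Real.norm_of_nonneg hβ0.le, mul_comm]
      gcongr ?_ * ?_
      · have := hM1 l z hz
        have h0 : 0 ≤ ∑ i, ‖(p i).eval z‖ := by positivity
        linarith
      · exact pow_le_pow_of_le_one hβ0.le hβ1.le (by omega)
    have a2 : ‖R.eval z - (p l).eval z‖ ≤ M' * (1 / 2) ^ k := by
      refine (hR l z hz).trans ?_
      gcongr
      refine hqk.trans ?_
      have : β ^ (2 * m * k) ≤ 1 := pow_le_one₀ hβ0.le hβ1.le
      have h5 : (0 : ℝ) ≤ (1 / 2) ^ k := by positivity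
      nlinarith
    refine (norm_add_le _ _).trans ?_
    linarith

lemma iteratedDeriv_poly (p : Polynomial ℂ) (k : ℕ) :
    iteratedDeriv k (fun z => p.eval z) 0 = (Nat.factorial k : ℂ) * p.coeff k := by
  have h : ∀ k : ℕ, deriv^[k] (fun z => p.eval z) =
      fun z => (Polynomial.derivative^[k] p).eval z := by
    intro k
    induction k with
    | zero => rfl
    | succ k ih =>
      rw [Function.iterate_succ_apply', ih, Function.iterate_succ_apply']
      ext z
      exact Polynomial.deriv _
  rw [iteratedDeriv_eq_iterate, h k]
  simp only
  rw [← Polynomial.coeff_zero_eq_eval_zero, Polynomial.coeff_iterate_derivative]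
  simp [Nat.descFactorial_self]

lemma construct (β : ℂ) (Ω : Set ℂ) (T : ℕ → ℂ → ℂ)
    (hstep : ∀ (j : ℕ) (P : Polynomial ℂ) (N : ℕ) (ε : ℝ), 0 < ε →
      ∃ (n : ℕ) (Q : Polynomial ℂ), N ≤ n ∧ Polynomial.X ^ N ∣ Q ∧ Q.natDegree ≤ n ∧
      (∀ z ∈ closedBall (0 : ℂ) 1, ‖Q.eval z‖ ≤ ε) ∧
      ∀ z ∈ Ω, ‖β ^ n * (P + Q).eval z - T j z‖ ≤ ε) :
    ∃ f : ℂ → ℂ, memA (closedBall 0 1) f ∧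
      ∀ j, ∃ n, 1 ≤ n ∧ ∀ z ∈ Ω, ‖β ^ n * taylorSum f 0 n z - T j z‖ ≤ (1 / 2) ^ j := by
  have hstep' : ∀ (j : ℕ) (s : Polynomial ℂ × ℕ), ∃ t : ℕ × Polynomial ℂ,
      s.2 + 1 ≤ t.1 ∧ Polynomial.X ^ (s.2 + 1) ∣ t.2 ∧ t.2.natDegree ≤ t.1 ∧
      (∀ z ∈ closedBall (0 : ℂ) 1, ‖t.2.eval z‖ ≤ (1 / 2 : ℝ) ^ j) ∧
      ∀ z ∈ Ω, ‖β ^ t.1 * (s.1 + t.2).eval z - T j z‖ ≤ (1 / 2 : ℝ) ^ j := by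
    intro j s
    obtain ⟨n, Q, h⟩ := hstep j s.1 (s.2 + 1) ((1 / 2 : ℝ) ^ j) (by positivity)
    exact ⟨(n, Q), h⟩
  choose t ht1 ht2 ht3 ht4 ht5 using hstep'
  let s : ℕ → Polynomial ℂ × ℕ := fun j =>
    Nat.rec (0, 0) (fun j s => (s.1 + (t j s).2, (t j s).1)) j
  let q : ℕ → Polynomial ℂ := fun j => (t j (s j)).2
  let P : ℕ → Polynomial ℂ := fun j => (s j).1
  let n : ℕ → ℕ := fun j => (s j).2
  have hP0 : P 0 = 0 := rfl
  have hP : ∀ j, P (j + 1) = P j + q j := fun j => rfl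
  have hn : ∀ j, n (j + 1) = (t j (s j)).1 := fun j => rfl
  have hnlt : ∀ j, n j + 1 ≤ n (j + 1) := fun j => ht1 j (s j)
  have hmono : Monotone n := monotone_nat_of_le_succ fun j => by have := hnlt j; omega
  have hdeg : ∀ j, (P j).natDegree ≤ n j := by
    intro j
    induction j with
    | zero => simp [hP0]
    | succ j ih =>
      rw [hP]
      refine (Polynomial.natDegree_add_le _ _).trans (max_le ?_ (ht3 j (s j)))
      have := hnlt j
      omega
  have hcoeff : ∀ j k, k ≤ n j → ∀ i, j ≤ i → (P i).coeff k = (P j).coeff k := by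
    intro j k hk i hi
    induction i, hi using Nat.le_induction with
    | base => rfl
    | succ i hi ih =>
      rw [hP, Polynomial.coeff_add, ih]
      have : (q i).coeff k = 0 := by
        have h := ht2 i (s i)
        rw [Polynomial.X_pow_dvd_iff] at h
        apply h
        have := hmono hi
        change k < n i + 1
        omega
      rw [this, add_zero]
  have hsum : ∀ i z, ∑ j ∈ Finset.range i, (q j).eval z = (P i).eval z := by
    intro i z
    induction i with
    | zero => simp [hP0]
    | succ i ih => rw [Finset.sum_range_succ, ih, hP, Polynomial.eval_add]
  have hgeo : Summable (fun j : ℕ => (1 / 2 : ℝ) ^ j) := summable_geometric_two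
  let f : ℂ → ℂ := fun z => ∑' j, (q j).eval z
  have hq : ∀ j, ∀ z ∈ closedBall (0 : ℂ) 1, ‖(q j).eval z‖ ≤ (1 / 2 : ℝ) ^ j :=
    fun j => ht4 j (s j)
  have hfc : ContinuousOn f (closedBall 0 1) :=
    continuousOn_tsum (fun j => (q j).continuous.continuousOn) hgeo hq
  have hfd : DifferentiableOn ℂ f (ball 0 1) :=
    Complex.differentiableOn_tsum_of_summable_norm hgeo
      (fun j => (q j).differentiable.differentiableOn) isOpen_ball
      (fun j z hz => hq j z (ball_subset_closedBall hz))
  have hunif := tendstoUniformlyOn_tsum_nat hgeo hq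
  have hder : ∀ j k, k ≤ n j → iteratedDeriv k f 0 = (Nat.factorial k : ℂ) * (P j).coeff k := by
    intro j k hk
    rw [← sub_eq_zero, ← norm_eq_zero]
    apply le_antisymm _ (norm_nonneg _)
    apply le_of_forall_pos_le_add
    intro ε hε
    rw [zero_add]
    rw [Metric.tendstoUniformlyOn_iff] at hunif
    have hkf : (0 : ℝ) < Nat.factorial k := by exact_mod_cast Nat.factorial_pos k
    obtain ⟨i, hi1, hi2⟩ := ((hunif (ε / Nat.factorial k) (by positivity)).and
      (eventually_ge_atTop j)).exists
    have hg : DiffContOnCl ℂ (f - fun z => (P i).eval z) (ball 0 1) := by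
      refine ⟨hfd.sub (P i).differentiable.differentiableOn, ?_⟩
      rw [closure_ball _ one_ne_zero]
      exact hfc.sub (P i).continuous.continuousOn
    have hb := Complex.norm_iteratedDeriv_le_of_forall_mem_sphere_norm_le k one_pos hg
      (C := ε / Nat.factorial k) (by
        intro z hz
        have := hi1 z (sphere_subset_closedBall hz)
        rw [hsum, dist_eq_norm] at this
        exact this.le)
    have hcd : ContDiffAt ℂ k f 0 :=
      (hfd.analyticAt (isOpen_ball.mem_nhds (by simp))).contDiffAt
    rw [iteratedDeriv_sub hcd ((P i).differentiable.contDiff.contDiffAt), iteratedDeriv_poly,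
      hcoeff j k hk i hi2] at hb
    refine hb.trans (le_of_eq ?_)
    field_simp
    simp
  refine ⟨f, ⟨hfc, ?_⟩, ?_⟩
  · rw [interior_closedBall _ one_ne_zero]; exact hfd
  · intro j
    refine ⟨n (j + 1), by have := hnlt j; omega, ?_⟩
    intro z hz
    have e : taylorSum f 0 (n (j + 1)) z = (P (j + 1)).eval z := by
      rw [Polynomial.eval_eq_sum_range' (Nat.lt_succ_of_le (hdeg (j + 1)))]
      apply Finset.sum_congr rfl
      intro k hk
      rw [hder (j + 1) k (by simp at hk; omega), sub_zero]
      have : (Nat.factorial k : ℂ) ≠ 0 := by exact_mod_cast Nat.factorial_ne_zero k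
      field_simp
    rw [e, hP]
    exact ht5 j (s j) z hz

lemma dense_targets (Ω : Set ℂ) (hΩ : IsCompact Ω) :
    ∃ T : ℕ → ℂ → ℂ, (∀ j, memA Ω (T j)) ∧
      ∀ h, memA Ω h → ∀ ε : ℝ, 0 < ε → ∀ b : ℕ, ∃ j, b ≤ j ∧ ∀ z ∈ Ω, ‖T j z - h z‖ ≤ ε := by
  have : CompactSpace Ω := isCompact_iff_compactSpace.1 hΩ
  let S : Set C(Ω, ℂ) := {F | ∃ h, memA Ω h ∧ ∀ x : Ω, F x = h x}
  have : Nonempty S := ⟨⟨0, fun _ => 0, ⟨continuousOn_const, differentiableOn_const _⟩, fun x => rfl⟩⟩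
  let u : ℕ → S := TopologicalSpace.denseSeq S
  have hu : DenseRange u := TopologicalSpace.denseRange_denseSeq S
  choose g hg1 hg2 using fun a => (u a).2
  refine ⟨fun j => g (Nat.unpair j).1, fun j => hg1 _, ?_⟩
  intro h hh ε hε b
  let F : S := ⟨⟨Ω.domRestrict h, hh.1.domRestrict⟩, h, hh, fun x => rfl⟩
  obtain ⟨a, ha⟩ := hu.exists_dist_lt F hε
  refine ⟨Nat.pair a b, Nat.right_le_pair a b, ?_⟩
  intro z hz
  simp only [Nat.unpair_pair]
  have h1 : dist ((F : C(Ω, ℂ)) ⟨z, hz⟩) ((u a : C(Ω, ℂ)) ⟨z, hz⟩) ≤ dist (F : C(Ω, ℂ)) (u a) :=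
    ContinuousMap.dist_apply_le_dist _
  rw [hg2 a ⟨z, hz⟩, dist_comm, dist_eq_norm] at h1
  exact h1.trans ha.le

lemma univ_nonempty (m : ℕ) (hm : 0 < m) (c : Fin (m + 1) → ℂ) (hc0 : c 0 = 0)
    (v : Fin (m + 1) → Polynomial ℂ)
    (hdeg : ∀ i, (v i).natDegree ≤ m) (β : ℝ) (hβ : β ∈ Set.Ioo (0 : ℝ) 1) (δ : ℝ) (hδ1 : δ ≤ 1)
    (hq : 8 * δ ≤ (β / 4) ^ (2 * m))
    (hv : ∀ i l, ∀ z ∈ closedBall (c l) 1, ‖(v i).eval z - (if i = l then 1 else 0)‖ ≤ δ)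
    (hX : ∀ i, i ≠ 0 → Polynomial.X ∣ v i) :
    (Uuniv 0 (closedBall (0:ℂ) 1) (⋃ (i : Fin (m + 1)) (_ : i ≠ 0), closedBall (c i) 1)
      (fun n => (β : ℂ) ^ n)).Nonempty := by
  set Ω : Set ℂ := ⋃ (i : Fin (m + 1)) (_ : i ≠ 0), closedBall (c i) 1 with hΩd
  have hΩ : IsCompact Ω := by
    apply isCompact_iUnion
    intro i
    apply isCompact_iUnion
    intro _
    exact isCompact_closedBall _ _
  have hK : IsCompact (⋃ i, closedBall (c i) 1) := isCompact_iUnion fun i => isCompact_closedBall _ _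
  have hsub : ∀ i, i ≠ 0 → closedBall (c i) 1 ⊆ Ω := fun i hi =>
    Set.subset_iUnion₂ (s := fun (i : Fin (m + 1)) (_ : i ≠ 0) => closedBall (c i) 1) i hi
  obtain ⟨T, hT, hTd⟩ := dense_targets Ω hΩ
  obtain ⟨f, hf, hfT⟩ := construct (β : ℂ) Ω T (by
    intro j P N ε hε
    have hp : ∀ i : Fin (m + 1), ∃ p : Polynomial ℂ, (i = 0 → p = 0) ∧
        (i ≠ 0 → ∀ z ∈ closedBall (c i) 1, ‖p.eval z - T j z‖ ≤ ε / 2) := by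
      intro i
      by_cases hi : i = 0
      · exact ⟨0, fun _ => rfl, fun h => absurd hi h⟩
      · obtain ⟨p, hp⟩ := disc_approx (c i) (T j) ((hT j).1.mono (hsub i hi))
          ((hT j).2.mono (interior_maximal (ball_subset_closedBall.trans (hsub i hi)) isOpen_ball))
          (ε / 2) (by positivity)
        exact ⟨p, fun h => absurd h hi, fun _ => hp⟩
    choose p hp0 hp1 using hp
    obtain ⟨n, Q, h1, h2, h3, h4, h5⟩ := step_lemma m hm (fun i => closedBall (c i) 1) v hK hdeg β hβ δ hδ1 hq hv hX
      P N p (hp0 0 rfl) (ε / 2) (by positivity)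
    refine ⟨n, Q, h1, h2, h3, ?_, ?_⟩
    · intro z hz
      rw [← hc0] at hz
      linarith [h4 z hz]
    · intro z hz
      rw [hΩd] at hz
      simp only [Set.mem_iUnion] at hz
      obtain ⟨i, hi, hz⟩ := hz
      have a := h5 i hi z hz
      have b := hp1 i hi z hz
      have := norm_add_le ((β : ℂ) ^ n * (P + Q).eval z - (p i).eval z) ((p i).eval z - T j z)
      rw [sub_add_sub_cancel] at this
      linarith)
  refine ⟨f, hf, ?_⟩
  intro h hh ε hε
  obtain ⟨b, hb⟩ := exists_pow_lt_of_lt_one (show 0 < ε / 3 by positivity) (show (1 / 2 : ℝ) < 1 by norm_num)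
  obtain ⟨j, hbj, hj⟩ := hTd h hh (ε / 3) (by positivity) b
  obtain ⟨n, hn1, hn⟩ := hfT j
  refine ⟨n, hn1, ?_⟩
  have hjb : (1 / 2 : ℝ) ^ j ≤ (1 / 2) ^ b := pow_le_pow_of_le_one (by norm_num) (by norm_num) hbj
  have : supNorm (fun z => (β : ℂ) ^ n * taylorSum f 0 n z - h z) Ω ≤ ε / 3 + ε / 3 := by
    apply supNorm_le _ _ _ (by positivity)
    intro z hz
    have a := hn z hz
    have b := hj z hz
    have := norm_add_le ((β : ℂ) ^ n * taylorSum f 0 n z - T j z) (T j z - h z)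
    rw [sub_add_sub_cancel] at this
    linarith
  linarith

/-- The unscaled centers. -/
noncomputable def ctr (m₀ : ℕ) (i : Fin (m₀ + 1)) : ℂ :=
  if i = 0 then 0 else
    Complex.exp (2 * Real.pi * Complex.I * (((i : ℕ) - 1 : ℕ) : ℂ) / (m₀ : ℂ))

lemma diskFamily_eq (m₀ : ℕ) (h₀ : ℝ) (i : Fin (m₀ + 1)) :
    diskFamily m₀ h₀ i = closedBall ((h₀ : ℂ) * ctr m₀ i) 1 := by
  unfold diskFamily ctr
  split_ifs <;> simp

lemma ctr_inj (m₀ : ℕ) (hm : 0 < m₀) : Function.Injective (ctr m₀) := by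
  intro i j hij
  unfold ctr at hij
  split_ifs at hij with hi hj hj
  · rw [hi, hj]
  · exact absurd hij.symm (Complex.exp_ne_zero _)
  · exact absurd hij (Complex.exp_ne_zero _)
  · have e : ∀ k : ℕ, Complex.exp (2 * Real.pi * Complex.I * (k : ℂ) / (m₀ : ℂ)) =
        Complex.exp (2 * Real.pi * Complex.I / m₀) ^ k := by
      intro k
      rw [← Complex.exp_nat_mul]; congr 1; ring
    rw [e, e] at hij
    have hi' : (i : ℕ) ≠ 0 := fun h => hi (Fin.ext h)
    have hj' : (j : ℕ) ≠ 0 := fun h => hj (Fin.ext h)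
    have := (Complex.isPrimitiveRoot_exp m₀ hm.ne').pow_inj (by omega) (by omega) hij
    apply Fin.ext
    omega

theorem stmt12 (β₀ : ℝ) (hβ : β₀ ∈ Set.Ioo (0:ℝ) 1) (m₀ : ℕ) (hm : 7 ≤ m₀) :
    ∃ H > (0:ℝ), ∀ h₀ : ℝ, H ≤ h₀ →
      (∀ i j : Fin (m₀ + 1), i ≠ j → Disjoint (diskFamily m₀ h₀ i) (diskFamily m₀ h₀ j)) ∧
      IsCompact (⋃ i, diskFamily m₀ h₀ i) ∧
      IsConnected (⋃ i, diskFamily m₀ h₀ i)ᶜ ∧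
      (∀ F : ℂ → ℂ, (∀ i : Fin (m₀ + 1), ∀ z ∈ diskFamily m₀ h₀ i, F z = ((i : ℕ) : ℂ)) →
        rho (⋃ i, diskFamily m₀ h₀ i) F < β₀) ∧
      (Uuniv 0 (Metric.closedBall (0:ℂ) 1)
        (⋃ (i : Fin (m₀ + 1)) (_ : i ≠ 0), diskFamily m₀ h₀ i)
        (fun n => ((β₀ : ℂ)) ^ n)).Nonempty := by
  have hm0 : 0 < m₀ := by omega
  have hβ0 := hβ.1
  have hβ1 := hβ.2
  have hinj := ctr_inj m₀ hm0
  set w := ctr m₀ with hw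
  let V : Fin (m₀ + 1) → Polynomial ℂ := fun i => Lagrange.basis Finset.univ w i
  have hVeval : ∀ i l, (V i).eval (w l) = if i = l then 1 else 0 := by
    intro i l
    split_ifs with h
    · subst h
      exact Lagrange.eval_basis_self hinj.injOn (Finset.mem_univ _)
    · exact Lagrange.eval_basis_of_ne h (Finset.mem_univ _)
  have hVdeg : ∀ i, (V i).natDegree ≤ m₀ := by
    intro i
    have := Lagrange.degree_basis (s := Finset.univ) hinj.injOn (Finset.mem_univ i)
    apply Polynomial.natDegree_le_of_degree_le
    rw [this]; simp
  let δ : ℝ := (β₀ / 4) ^ (2 * m₀) / 8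
  have hδ : 0 < δ := by positivity
  have hδ1 : δ ≤ 1 := by
    have : (β₀ / 4) ^ (2 * m₀) ≤ 1 := pow_le_one₀ (by positivity) (by linarith)
    simp only [δ]; linarith
  have hq : 8 * δ ≤ (β₀ / 4) ^ (2 * m₀) := by simp only [δ]; linarith
  have ev1 : ∀ᶠ h : ℝ in atTop, ∀ i l, ∀ y ∈ closedBall (w l) (1 / h),
      ‖(V i).eval y - (if i = l then 1 else 0)‖ ≤ δ := by
    rw [eventually_all]; intro i
    rw [eventually_all]; intro l
    obtain ⟨η, hη, H⟩ := Metric.continuous_iff.1 (V i).continuous (w l) δ hδ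
    filter_upwards [eventually_gt_atTop (1 / η), eventually_gt_atTop 0] with h h1 h0 y hy
    have := H y (lt_of_le_of_lt hy (by rwa [div_lt_comm₀ h0 hη]))
    rw [hVeval, dist_eq_norm] at this
    exact this.le
  have ev2 : ∀ᶠ h : ℝ in atTop, ∀ i j, i ≠ j → 5 ≤ h * ‖w i - w j‖ := by
    rw [eventually_all]; intro i
    rw [eventually_all]; intro j
    by_cases hij : i = j
    · exact Eventually.of_forall fun h hne => absurd hij hne
    · have hpos : 0 < ‖w i - w j‖ := by
        rw [norm_pos_iff, sub_ne_zero]; exact fun h => hij (hinj h)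
      filter_upwards [(tendsto_id.atTop_mul_const hpos).eventually_ge_atTop 5] with h hh _
      exact hh
  obtain ⟨H, hH⟩ := eventually_atTop.1 (ev1.and (ev2.and (eventually_gt_atTop 0)))
  refine ⟨max H 1, by positivity, ?_⟩
  intro h₀ hh₀
  obtain ⟨e1, e2, hpos⟩ := hH h₀ ((le_max_left _ _).trans hh₀)
  have hfam : diskFamily m₀ h₀ = fun i => closedBall ((h₀ : ℂ) * w i) 1 := by
    ext1 i; exact diskFamily_eq m₀ h₀ i
  rw [hfam]
  have hsep : ∀ i j, i ≠ j → 5 ≤ ‖(h₀ : ℂ) * w i - (h₀ : ℂ) * w j‖ := by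
    intro i j hij
    rw [← mul_sub, norm_mul, Complex.norm_real, Real.norm_of_nonneg hpos.le]
    exact e2 i j hij
  have hh0c : (h₀ : ℂ) ≠ 0 := by exact_mod_cast hpos.ne'
  let v : Fin (m₀ + 1) → Polynomial ℂ := fun i =>
    (V i).comp (Polynomial.C (h₀ : ℂ)⁻¹ * Polynomial.X)
  have hvdeg : ∀ i, (v i).natDegree ≤ m₀ := by
    intro i
    refine Polynomial.natDegree_comp_le.trans ?_
    have : (Polynomial.C (h₀ : ℂ)⁻¹ * Polynomial.X : Polynomial ℂ).natDegree ≤ 1 :=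
      (Polynomial.natDegree_C_mul_le _ _).trans Polynomial.natDegree_X_le
    calc _ ≤ m₀ * 1 := Nat.mul_le_mul (hVdeg i) this
      _ = m₀ := mul_one _
  have hv : ∀ i l, ∀ z ∈ closedBall ((h₀ : ℂ) * w l) 1,
      ‖(v i).eval z - (if i = l then 1 else 0)‖ ≤ δ := by
    intro i l z hz
    simp only [v, Polynomial.eval_comp, Polynomial.eval_mul, Polynomial.eval_C, Polynomial.eval_X]
    apply e1
    rw [mem_closedBall, dist_eq_norm] at hz ⊢
    rw [show (h₀ : ℂ)⁻¹ * z - w l = (h₀ : ℂ)⁻¹ * (z - h₀ * w l) by field_simp, norm_mul, norm_inv,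
      Complex.norm_real, Real.norm_of_nonneg hpos.le, one_div]
    exact mul_le_of_le_one_right (by positivity) hz
  have hw0 : w 0 = 0 := by simp [hw, ctr]
  have hX : ∀ i, i ≠ 0 → Polynomial.X ∣ v i := by
    intro i hi
    rw [Polynomial.X_dvd_iff, Polynomial.coeff_zero_eq_eval_zero]
    simp only [v, Polynomial.eval_comp, Polynomial.eval_mul, Polynomial.eval_C, Polynomial.eval_X]
    have := hVeval i 0
    rw [hw0, if_neg hi] at this
    simpa using this
  refine ⟨?_, isCompact_iUnion fun i => isCompact_closedBall _ _, compl_balls_connected _ hsep, ?_, ?_⟩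
  · intro i j hij
    apply closedBall_disjoint_closedBall
    rw [dist_eq_norm]
    linarith [hsep i j hij]
  · intro F hF
    exact rho_lt m₀ hm0 _ v hvdeg β₀ hβ δ hδ1 hq hv F hF
  · exact univ_nonempty m₀ hm0 (fun i => (h₀ : ℂ) * w i) (by simp [hw0]) v hvdeg β₀ hβ δ hδ1 hq hv hX
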